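/- arXiv:math/9705201 — 15 statements merged into one kernel-verified Lean document; each statement's English description precedes it below -/
import Mathlib

section
/- Let a₁, a₂, b₁, c₁, c₂ be complex numbers, and for ζ ∈ ℂ set r(ζ) = b₁|ζ|² + c₁·conj(ζ) + c₂, s(ζ) = a₁|ζ|² + b₁·conj(ζ) + a₂ζ, and p₁(ζ) = −a₂b₁ζ² + (a₁c₂ − a₂c₁)ζ + b₁c₂. Suppose ζ₀ ∈ ℂ satisfies p₁(ζ₀) = 0, r(ζ₀) ≠ 0 and b₁ζ₀ + c₁ ≠ 0, and suppose the complex numbers A¹₁, A¹₂, A²₁, A²₂ satisfy conj(A¹₂) = ζ₀·conj(A²₂) and conj(A²₁) = −conj(A¹₁)·s(ζ₀)/r(ζ₀). Then conj(A¹₁)·conj(A²₂) − conj(A¹₂)·conj(A²₁) = (conj(A¹₁)·conj(A²₂)/(b₁ζ₀ + c₁))·(a₁ζ₀² + 2b₁ζ₀ + c₁). (Lemma 8.1.3) -/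
open ComplexConjugate

/-- Lemma 8.1.3: if `ζ₀` is a root of `p₁` with `r(ζ₀) ≠ 0` and `b₁ζ₀ + c₁ ≠ 0`, and the
matrix entries satisfy `Ā¹₂ = ζ₀Ā²₂`, `Ā²₁ = −Ā¹₁·s(ζ₀)/r(ζ₀)`, then
`Ā¹₁Ā²₂ − Ā¹₂Ā²₁ = (Ā¹₁Ā²₂/(b₁ζ₀ + c₁))·(a₁ζ₀² + 2b₁ζ₀ + c₁)`. -/
theorem ebenfelt_lemma_8_1_3 (a₁ a₂ b₁ c₁ c₂ ζ₀ : ℂ)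
    (hp : -a₂*b₁*ζ₀^2 + (a₁*c₂ - a₂*c₁)*ζ₀ + b₁*c₂ = 0)
    (hr : b₁*(ζ₀*conj ζ₀) + c₁*conj ζ₀ + c₂ ≠ 0)
    (hbc : b₁*ζ₀ + c₁ ≠ 0)
    (A11 A12 A21 A22 : ℂ)
    (h12 : conj A12 = ζ₀ * conj A22)
    (h21 : conj A21 = -conj A11 * (a₁*(ζ₀*conj ζ₀) + b₁*conj ζ₀ + a₂*ζ₀)
            / (b₁*(ζ₀*conj ζ₀) + c₁*conj ζ₀ + c₂)) :
    conj A11 * conj A22 - conj A12 * conj A21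
      = (conj A11 * conj A22 / (b₁*ζ₀ + c₁)) * (a₁*ζ₀^2 + 2*b₁*ζ₀ + c₁) := by
  have key : (a₁*(ζ₀*conj ζ₀) + b₁*conj ζ₀ + a₂*ζ₀) / (b₁*(ζ₀*conj ζ₀) + c₁*conj ζ₀ + c₂)
      = (a₁*ζ₀ + b₁) / (b₁*ζ₀ + c₁) := by
    rw [div_eq_div_iff hr hbc]
    linear_combination -hp
  rw [h12, h21, mul_div_assoc, key]
  linear_combination -(conj A11 * conj A22) * mul_inv_cancel₀ hbc
end

section
/- Assume b₂ = 0, b₁c₂ − b₂c₁ = 0, a₁c₂ − a₂c₁ = 0 and a₁b₂ − a₂b₁ ≠ 0 (so a₂b₁ ≠ 0). Then for every invertible matrix A (i.e. A¹₁A²₂ − A¹₂A²₁ ≠ 0) with b′₂ = 0, one has a′₂·b′₁ ≠ 0. (Assertion 7.2.1) -/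
open ComplexConjugate

/-- Transformed coefficient a′₁ under the linear change of coordinates with matrix
`A = (Aʲₖ)`, as in (7.1.7) of the paper. -/
noncomputable def ta1 (a₁ a₂ b₁ b₂ c₁ c₂ A11 A12 A21 A22 : ℂ) : ℂ :=
  A11 * (a₁ * (conj A11)^2 + 2*b₁*(conj A11)*(conj A21) + c₁*(conj A21)^2)
  + A21 * (a₂ * (conj A11)^2 + 2*b₂*(conj A11)*(conj A21) + c₂*(conj A21)^2)

/-- Transformed coefficient a′₂. -/
noncomputable def ta2 (a₁ a₂ b₁ b₂ c₁ c₂ A11 A12 A21 A22 : ℂ) : ℂ :=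
  A12 * (a₁ * (conj A11)^2 + 2*b₁*(conj A11)*(conj A21) + c₁*(conj A21)^2)
  + A22 * (a₂ * (conj A11)^2 + 2*b₂*(conj A11)*(conj A21) + c₂*(conj A21)^2)

/-- Transformed coefficient b′₁. -/
noncomputable def tb1 (a₁ a₂ b₁ b₂ c₁ c₂ A11 A12 A21 A22 : ℂ) : ℂ :=
  A11 * (a₁*(conj A11)*(conj A12) + b₁*((conj A11)*(conj A22) + (conj A21)*(conj A12))
          + c₁*(conj A21)*(conj A22))
  + A21 * (a₂*(conj A11)*(conj A12) + b₂*((conj A11)*(conj A22) + (conj A21)*(conj A12))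
          + c₂*(conj A21)*(conj A22))

/-- Transformed coefficient b′₂. -/
noncomputable def tb2 (a₁ a₂ b₁ b₂ c₁ c₂ A11 A12 A21 A22 : ℂ) : ℂ :=
  A12 * (a₁*(conj A11)*(conj A12) + b₁*((conj A11)*(conj A22) + (conj A21)*(conj A12))
          + c₁*(conj A21)*(conj A22))
  + A22 * (a₂*(conj A11)*(conj A12) + b₂*((conj A11)*(conj A22) + (conj A21)*(conj A12))
          + c₂*(conj A21)*(conj A22))

/-- Transformed coefficient c′₁. -/
noncomputable def tc1 (a₁ a₂ b₁ b₂ c₁ c₂ A11 A12 A21 A22 : ℂ) : ℂ :=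
  A11 * (a₁*(conj A12)^2 + 2*b₁*(conj A12)*(conj A22) + c₁*(conj A22)^2)
  + A21 * (a₂*(conj A12)^2 + 2*b₂*(conj A12)*(conj A22) + c₂*(conj A22)^2)

/-- Transformed coefficient c′₂. -/
noncomputable def tc2 (a₁ a₂ b₁ b₂ c₁ c₂ A11 A12 A21 A22 : ℂ) : ℂ :=
  A12 * (a₁*(conj A12)^2 + 2*b₁*(conj A12)*(conj A22) + c₁*(conj A22)^2)
  + A22 * (a₂*(conj A12)^2 + 2*b₂*(conj A12)*(conj A22) + c₂*(conj A22)^2)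

/-- Assertion 7.2.1: if `b₂ = 0`, `Δ_bc = Δ_ac = 0` and `Δ_ab ≠ 0`, then after any
invertible linear change of coordinates with `b′₂ = 0`, the product `a′₂·b′₁` is non-zero. -/
theorem ebenfelt_assertion_7_2_1 (a₁ a₂ b₁ b₂ c₁ c₂ : ℂ)
    (hb2 : b₂ = 0) (hbc : b₁*c₂ - b₂*c₁ = 0) (hac : a₁*c₂ - a₂*c₁ = 0)
    (hab : a₁*b₂ - a₂*b₁ ≠ 0) :
    ∀ A11 A12 A21 A22 : ℂ, A11*A22 - A12*A21 ≠ 0 →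
      tb2 a₁ a₂ b₁ b₂ c₁ c₂ A11 A12 A21 A22 = 0 →
      ta2 a₁ a₂ b₁ b₂ c₁ c₂ A11 A12 A21 A22 * tb1 a₁ a₂ b₁ b₂ c₁ c₂ A11 A12 A21 A22 ≠ 0 := by
  intro A11 A12 A21 A22 hA hb
  subst hb2
  have ha2 : a₂ ≠ 0 := by rintro rfl; simp at hab
  have hb1 : b₁ ≠ 0 := by rintro rfl; simp at hab
  have hc2 : c₂ = 0 := by simpa [hb1] using hbc
  subst hc2
  have hc1 : c₁ = 0 := by simpa [ha2] using hac
  subst hc1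
  have hconj : conj A11 * conj A22 - conj A12 * conj A21 ≠ 0 := by
    rw [← map_mul, ← map_mul, ← map_sub]
    exact (map_ne_zero _).mpr hA
  have hA12 : conj A12 = 0 ↔ A12 = 0 := map_eq_zero _
  simp only [tb2, ta2, tb1] at hb ⊢
  generalize conj A11 = p at *
  generalize conj A12 = q at *
  generalize conj A21 = r at *
  generalize conj A22 = s at *
  refine mul_ne_zero (fun ha => ?_) (fun hb' => ?_)
  · have hp : p ≠ 0 := by
      rintro rfl
      have h : A12 * b₁ * (r * q) = 0 := by linear_combination hb
      have hrq : r * q ≠ 0 := fun h => hconj (by linear_combination -h)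
      have h12 : A12 = 0 := by simpa [hb1, hrq] using h
      exact hrq (by simp [hA12.mpr h12])
    have h : p * b₁ * (p * s - q * r) * A12 = 0 := by
      linear_combination p * hb - q * ha
    have h12 : A12 = 0 := by simpa [hp, hb1, hconj] using h
    subst h12
    have h22 : A22 = 0 := by simpa [ha2, hp] using ha
    exact hA (by simp [h22])
  · have h1 : (A11 * A22 - A12 * A21) * (a₂ * (p * q)) = 0 := by
      linear_combination A11 * hb - A12 * hb'
    have h2 : (A11 * A22 - A12 * A21) * (a₁ * p * q + b₁ * (p * s + r * q)) = 0 := by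
      linear_combination A22 * hb' - A21 * hb
    have hpq : p * q = 0 := by
      simpa only [mul_eq_zero, hA, ha2, false_or] using h1
    have hsum : p * s + r * q = 0 := by
      have h := (mul_eq_zero.mp h2).resolve_left hA
      exact (mul_eq_zero.mp (by linear_combination h - a₁ * hpq :
        b₁ * (p * s + r * q) = 0)).resolve_left hb1
    rcases mul_eq_zero.mp hpq with rfl | rfl
    · exact hconj (by linear_combination -hsum)
    · exact hconj (by linear_combination hsum)
end

section
/- Assume b₂ = 0, a₁b₂ − a₂b₁ = 0, a₁c₂ − a₂c₁ = 0 and b₁c₂ ≠ 0 (so a₁ = a₂ = 0). Then for every invertible matrix A (i.e. A¹₁A²₂ − A¹₂A²₁ ≠ 0) with b′₂ = 0, one has b′₁·c′₂ ≠ 0. (Assertion 7.3.1) -/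
open ComplexConjugate

/-- Assertion 7.3.1: if `b₂ = 0`, `Δ_ab = Δ_ac = 0` and `Δ_bc = b₁c₂ ≠ 0`, then after any
invertible linear change of coordinates with `b′₂ = 0`, the product `b′₁·c′₂` is non-zero. -/
theorem ebenfelt_assertion_7_3_1 (a₁ a₂ b₁ b₂ c₁ c₂ : ℂ)
    (hb2 : b₂ = 0) (hab : a₁*b₂ - a₂*b₁ = 0) (hac : a₁*c₂ - a₂*c₁ = 0)
    (hbc : b₁*c₂ ≠ 0) :
    ∀ A11 A12 A21 A22 : ℂ, A11*A22 - A12*A21 ≠ 0 →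
      tb2 a₁ a₂ b₁ b₂ c₁ c₂ A11 A12 A21 A22 = 0 →
      tb1 a₁ a₂ b₁ b₂ c₁ c₂ A11 A12 A21 A22 * tc2 a₁ a₂ b₁ b₂ c₁ c₂ A11 A12 A21 A22 ≠ 0 := by
  intro p q r s hD h
  have hb1 : b₁ ≠ 0 := left_ne_zero_of_mul hbc
  have hc2 : c₂ ≠ 0 := right_ne_zero_of_mul hbc
  subst hb2
  have ha2 : a₂ = 0 := by simpa [hb1] using hab
  subst ha2
  have ha1 : a₁ = 0 := by simpa [hc2] using hac
  subst ha1
  have hD' : conj p * conj s - conj q * conj r ≠ 0 := by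
    simpa only [map_sub, map_mul] using (map_ne_zero (starRingEnd ℂ)).2 hD
  unfold tb2 at h
  refine mul_ne_zero (fun h1 => ?_) (fun h2 => ?_)
  · unfold tb1 at h1
    have hB2 : conj r * conj s = 0 := by
      refine (mul_eq_zero.1 ?_).resolve_left (mul_ne_zero hD hc2)
      linear_combination p * h - q * h1
    have hB1 : conj p * conj s + conj r * conj q = 0 := by
      refine (mul_eq_zero.1 ?_).resolve_left (mul_ne_zero hD hb1)
      linear_combination s * h1 - r * h - (p * s - q * r) * c₁ * hB2
    rcases mul_eq_zero.1 hB2 with hr | hs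
    · apply hD'
      linear_combination hB1 - 2 * conj q * hr
    · apply hD'
      linear_combination -hB1 + 2 * conj p * hs
  · unfold tc2 at h2
    have key : (b₁ * (conj p * conj s - conj q * conj r)) * (q * conj s) = 0 := by
      linear_combination conj s * h - conj r * h2
    rcases mul_eq_zero.1 ((mul_eq_zero.1 key).resolve_left (mul_ne_zero hb1 hD')) with hq | hs
    · subst hq
      have hs : s ≠ 0 := by
        rintro rfl
        simp at hD
      simp [hs, hc2] at h2
    · have hs0 : s = 0 := (map_eq_zero (starRingEnd ℂ)).1 hs
      subst hs0
      have hqr : q ≠ 0 ∧ r ≠ 0 := by simpa using hD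
      simp [hqr.1, hqr.2, hb1] at h
end

section
/- Assume b₁ = b₂ = 0 and a₁c₂ − a₂c₁ ≠ 0. Then for every invertible matrix A (i.e. A¹₁A²₂ − A¹₂A²₁ ≠ 0) with b′₂ = 0, one has (a′₁, a′₂) ≠ (0, 0) and (c′₁, c′₂) ≠ (0, 0). (Assertion 7.4.1) -/
open ComplexConjugate

/-- A homogeneous `2 × 2` linear system with nonzero determinant has only the zero solution. -/
lemma eq_zero_and_eq_zero_of_det_ne_zero {K : Type*} [Field K] {x y z w s t : K}
    (hdet : x * w - y * z ≠ 0) (h₁ : x * s + z * t = 0) (h₂ : y * s + w * t = 0) :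
    s = 0 ∧ t = 0 := by
  constructor
  · refine (mul_eq_zero.mp ?_).resolve_left hdet
    linear_combination w * h₁ - z * h₂
  · refine (mul_eq_zero.mp ?_).resolve_left hdet
    linear_combination x * h₂ - y * h₁

/-- Assertion 7.4.1: if `b₁ = b₂ = 0` and `Δ_ac = a₁c₂ − a₂c₁ ≠ 0`, then after any
invertible linear change of coordinates with `b′₂ = 0`, neither `(a′₁, a′₂)` nor
`(c′₁, c′₂)` vanishes. -/
theorem ebenfelt_assertion_7_4_1 (a₁ a₂ b₁ b₂ c₁ c₂ : ℂ)
    (hb1 : b₁ = 0) (hb2 : b₂ = 0) (hac : a₁*c₂ - a₂*c₁ ≠ 0) :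
    ∀ A11 A12 A21 A22 : ℂ, A11*A22 - A12*A21 ≠ 0 →
      tb2 a₁ a₂ b₁ b₂ c₁ c₂ A11 A12 A21 A22 = 0 →
      (¬ (ta1 a₁ a₂ b₁ b₂ c₁ c₂ A11 A12 A21 A22 = 0 ∧ ta2 a₁ a₂ b₁ b₂ c₁ c₂ A11 A12 A21 A22 = 0)
        ∧ ¬ (tc1 a₁ a₂ b₁ b₂ c₁ c₂ A11 A12 A21 A22 = 0 ∧ tc2 a₁ a₂ b₁ b₂ c₁ c₂ A11 A12 A21 A22 = 0)) := by
  intro A11 A12 A21 A22 hA _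
  subst hb1 hb2
  simp only [ta1, ta2, tc1, tc2, mul_zero, zero_mul, add_zero]
  constructor
  · rintro ⟨h₁, h₂⟩
    obtain ⟨hs, ht⟩ := eq_zero_and_eq_zero_of_det_ne_zero hA h₁ h₂
    obtain ⟨hp, hq⟩ := eq_zero_and_eq_zero_of_det_ne_zero (s := conj A11 ^ 2) (t := conj A21 ^ 2)
      hac (by linear_combination hs) (by linear_combination ht)
    simp only [pow_eq_zero_iff two_ne_zero, map_eq_zero] at hp hq
    simp [hp, hq] at hA
  · rintro ⟨h₁, h₂⟩
    obtain ⟨hs, ht⟩ := eq_zero_and_eq_zero_of_det_ne_zero hA h₁ h₂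
    obtain ⟨hp, hq⟩ := eq_zero_and_eq_zero_of_det_ne_zero (s := conj A12 ^ 2) (t := conj A22 ^ 2)
      hac (by linear_combination hs) (by linear_combination ht)
    simp only [pow_eq_zero_iff two_ne_zero, map_eq_zero] at hp hq
    simp [hp, hq] at hA
end

section
/- Assume b₂ = 0. Let ζ ∈ ℂ satisfy r(ζ) ≠ 0, and suppose the matrix entries satisfy conj(A¹₂) = ζ·conj(A²₂), conj(A²₁) = −conj(A¹₁)·s(ζ)/r(ζ), and A¹₁A²₂ − A¹₂A²₁ ≠ 0. Then b′₁ = 0 if and only if p₁(ζ) = 0. (Content of formula (7.1.18)) -/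
open ComplexConjugate

/-- Content of formula (7.1.18): assume `b₂ = 0`; if `r(ζ) ≠ 0`,
`Ā¹₂ = ζĀ²₂`, `Ā²₁ = −Ā¹₁·s(ζ)/r(ζ)` and the matrix is invertible, then
`b′₁ = 0` iff `p₁(ζ) = 0`. -/
theorem ebenfelt_formula_7_1_18 (a₁ a₂ b₁ b₂ c₁ c₂ : ℂ) (hb2 : b₂ = 0) (ζ : ℂ)
    (hr : b₁*(ζ*conj ζ) + c₁*conj ζ + c₂ ≠ 0)
    (A11 A12 A21 A22 : ℂ)
    (h12 : conj A12 = ζ * conj A22)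
    (h21 : conj A21 = -conj A11 * (a₁*(ζ*conj ζ) + b₁*conj ζ + a₂*ζ)
            / (b₁*(ζ*conj ζ) + c₁*conj ζ + c₂))
    (hdet : A11*A22 - A12*A21 ≠ 0) :
    tb1 a₁ a₂ b₁ b₂ c₁ c₂ A11 A12 A21 A22 = 0 ↔
      -a₂*b₁*ζ^2 + (a₁*c₂ - a₂*c₁)*ζ + b₁*c₂ = 0 := by
  subst hb2
  have hr' := (map_ne_zero (starRingEnd ℂ)).2 hr
  rw [eq_div_iff hr] at h21
  have h21' := congrArg conj h21
  have h12' := congrArg conj h12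
  simp only [map_add, map_mul, map_neg, Complex.conj_conj] at h21' hr' h12'
  have h11 : A11 ≠ 0 := by
    rintro rfl
    have h : A21 = 0 := by simpa [hr'] using h21'
    simp [h] at hdet
  have h22 : A22 ≠ 0 := by
    rintro rfl
    simp [h12'] at hdet
  have h11' := (map_ne_zero (starRingEnd ℂ)).2 h11
  have h22' := (map_ne_zero (starRingEnd ℂ)).2 h22
  -- Up to nonzero factors, the determinant of `A` is the conjugate of `r(ζ) + ζ s(ζ)`.
  have hdet_mul : (A11*A22 - A12*A21) * (conj b₁*(conj ζ*ζ) + conj c₁*ζ + conj c₂)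
      = A11 * A22 * ((conj b₁*(conj ζ*ζ) + conj c₁*ζ + conj c₂)
        + conj ζ * (conj a₁*(conj ζ*ζ) + conj b₁*ζ + conj a₂*conj ζ)) := by
    rw [h12']
    linear_combination (-conj ζ * A22) * h21'
  have hrs := right_ne_zero_of_mul (hdet_mul ▸ mul_ne_zero hdet hr')
  have key : tb1 a₁ a₂ b₁ 0 c₁ c₂ A11 A12 A21 A22
      * ((b₁*(ζ*conj ζ) + c₁*conj ζ + c₂) * (conj b₁*(conj ζ*ζ) + conj c₁*ζ + conj c₂))
      = (A11 * conj A11 * conj A22 * ((conj b₁*(conj ζ*ζ) + conj c₁*ζ + conj c₂)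
        + conj ζ * (conj a₁*(conj ζ*ζ) + conj b₁*ζ + conj a₂*conj ζ)))
        * (-a₂*b₁*ζ^2 + (a₁*c₂ - a₂*c₁)*ζ + b₁*c₂) := by
    unfold tb1
    rw [h12]
    linear_combination
      (conj A22 * (A11 * (b₁*ζ + c₁) + A21 * c₂)
        * (conj b₁*(conj ζ*ζ) + conj c₁*ζ + conj c₂)) * h21
      + (conj A11 * conj A22 * (a₂*ζ*(b₁*(ζ*conj ζ) + c₁*conj ζ + c₂)
        - c₂*(a₁*(ζ*conj ζ) + b₁*conj ζ + a₂*ζ))) * h21'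
  rw [← mul_eq_zero_iff_right (mul_ne_zero hr hr'), key,
    mul_eq_zero_iff_left (mul_ne_zero (mul_ne_zero (mul_ne_zero h11 h11') h22') hrs)]
end

section
/- Assume b₁ = b₂ = 0. Let ζ ∈ ℂ satisfy r(ζ) = c₁·conj(ζ) + c₂ ≠ 0, and suppose conj(A¹₂) = ζ·conj(A²₂) and conj(A²₁) = −conj(A¹₁)·s(ζ)/r(ζ), where s(ζ) = a₁|ζ|² + a₂ζ. Then a′₂ = A²₂·(conj(A¹₁))²·(c₁·conj(ζ) + c₂)·(a₁·conj(ζ) + a₂)·(r(ζ) + ζ·s(ζ))/r(ζ)². (Formula (7.4.4)) -/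
open ComplexConjugate

/-- Formula (7.4.4): assume `b₁ = b₂ = 0`; if `r(ζ) = c₁ζ̄ + c₂ ≠ 0`,
`Ā¹₂ = ζĀ²₂` and `Ā²₁ = −Ā¹₁·s(ζ)/r(ζ)` with `s(ζ) = a₁|ζ|² + a₂ζ`, then
`a′₂ = A²₂(Ā¹₁)²(c₁ζ̄ + c₂)(a₁ζ̄ + a₂)(r(ζ) + ζs(ζ))/r(ζ)²`. -/
theorem ebenfelt_formula_7_4_4 (a₁ a₂ b₁ b₂ c₁ c₂ : ℂ)
    (hb1 : b₁ = 0) (hb2 : b₂ = 0) (ζ : ℂ)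
    (hr : c₁*conj ζ + c₂ ≠ 0)
    (A11 A12 A21 A22 : ℂ)
    (h12 : conj A12 = ζ * conj A22)
    (h21 : conj A21 = -conj A11 * (a₁*(ζ*conj ζ) + a₂*ζ) / (c₁*conj ζ + c₂)) :
    ta2 a₁ a₂ b₁ b₂ c₁ c₂ A11 A12 A21 A22
      = A22 * (conj A11)^2 * (c₁*conj ζ + c₂) * (a₁*conj ζ + a₂)
          * ((c₁*conj ζ + c₂) + ζ*(a₁*(ζ*conj ζ) + a₂*ζ))
          / (c₁*conj ζ + c₂)^2 := by
  have hA12 : A12 = conj ζ * A22 := by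
    simpa using congrArg conj h12
  rw [ta2, hb1, hb2, h21, hA12]
  generalize hR : c₁ * conj ζ + c₂ = r at hr ⊢
  field_simp
  rw [← hR]
  ring
end

section
/- Assume b₂ = 0, a₁c₂ − a₂c₁ = 0, a₂b₁ ≠ 0 and b₁c₂ ≠ 0. Then there exist complex numbers A¹₁, A¹₂, A²₁, A²₂ with A¹₁A²₂ − A¹₂A²₁ ≠ 0 such that b′₁ = 0 and b′₂ = 0. (Case Δ_ac = 0, Δ_ab·Δ_bc ≠ 0 of the proof of Theorem A (ii), Section 8.2) -/
open ComplexConjugate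

/-- Section 8.2 (case `Δ_ac = 0`, `Δ_ab·Δ_bc ≠ 0`): there is an invertible linear change
of coordinates making both `b′₁` and `b′₂` vanish. -/
theorem ebenfelt_section_8_2 (a₁ a₂ b₁ b₂ c₁ c₂ : ℂ)
    (hb2 : b₂ = 0) (hac : a₁*c₂ - a₂*c₁ = 0) (hab : a₂*b₁ ≠ 0) (hbc : b₁*c₂ ≠ 0) :
    ∃ A11 A12 A21 A22 : ℂ, A11*A22 - A12*A21 ≠ 0 ∧
      tb1 a₁ a₂ b₁ b₂ c₁ c₂ A11 A12 A21 A22 = 0 ∧ tb2 a₁ a₂ b₁ b₂ c₁ c₂ A11 A12 A21 A22 = 0 := by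
  subst hb2
  have ha : a₂ ≠ 0 := left_ne_zero_of_mul hab
  have hc : c₂ ≠ 0 := right_ne_zero_of_mul hbc
  obtain ⟨t, ht⟩ := IsAlgClosed.exists_pow_nat_eq (a₂ / c₂) (n := 2) two_pos
  have hQ : a₂ - c₂ * t ^ 2 = 0 := by
    rw [ht]
    field_simp
    ring
  have hP : a₁ - c₁ * t ^ 2 = 0 := by
    refine (mul_eq_zero.mp (?_ : c₂ * (a₁ - c₁ * t ^ 2) = 0)).resolve_left hc
    linear_combination hac + c₁ * hQ
  have ht0 : t ≠ 0 := by
    rintro rfl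
    exact ha (by simpa using hQ)
  have hw0 : conj t ≠ 0 := (map_ne_zero _).mpr ht0
  refine ⟨1, 1, conj t, -conj t, ?_, ?_, ?_⟩
  · intro h
    exact hw0 (by linear_combination (-1 / 2 : ℂ) * h)
  · simp only [tb1, map_one, map_neg, Complex.conj_conj]
    linear_combination hP + conj t * hQ
  · simp only [tb2, map_one, map_neg, Complex.conj_conj]
    linear_combination hP - conj t * hQ
end

section
/- Assume b₂ = 0, a₂ = 0 and a₁b₁c₂ ≠ 0. Then there exist complex numbers A¹₁, A¹₂, A²₁, A²₂ with A¹₁A²₂ − A¹₂A²₁ ≠ 0 such that b′₁ = 0 and b′₂ = 0; in fact any choice with conj(A²₂) = 0, conj(A²₁) = −conj(A¹₁)·a₁/b₁ and A¹₁A¹₂ ≠ 0 works. (Case Δ_ab = 0, Δ_ac·Δ_bc ≠ 0 of the proof of Theorem A (ii), Section 8.3) -/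
open ComplexConjugate

/-- Section 8.3 (case `Δ_ab = 0`, `Δ_ac·Δ_bc ≠ 0`): there is an invertible linear change
of coordinates making `b′₁ = b′₂ = 0`; in fact any choice with `Ā²₂ = 0`,
`Ā²₁ = −Ā¹₁a₁/b₁` and `A¹₁A¹₂ ≠ 0` works. -/
theorem ebenfelt_section_8_3 (a₁ a₂ b₁ b₂ c₁ c₂ : ℂ)
    (hb2 : b₂ = 0) (ha2 : a₂ = 0) (h : a₁*b₁*c₂ ≠ 0) :
    (∃ A11 A12 A21 A22 : ℂ, A11*A22 - A12*A21 ≠ 0 ∧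
      tb1 a₁ a₂ b₁ b₂ c₁ c₂ A11 A12 A21 A22 = 0 ∧ tb2 a₁ a₂ b₁ b₂ c₁ c₂ A11 A12 A21 A22 = 0) ∧
    (∀ A11 A12 A21 A22 : ℂ, conj A22 = 0 → conj A21 = -conj A11 * a₁ / b₁ →
      A11 * A12 ≠ 0 →
      (A11*A22 - A12*A21 ≠ 0 ∧ tb1 a₁ a₂ b₁ b₂ c₁ c₂ A11 A12 A21 A22 = 0 ∧ tb2 a₁ a₂ b₁ b₂ c₁ c₂ A11 A12 A21 A22 = 0)) := by
  subst hb2 ha2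
  have ha : a₁ ≠ 0 := fun h0 => h (by simp [h0])
  have hb : b₁ ≠ 0 := fun h0 => h (by simp [h0])
  have key : ∀ A11 A12 A21 A22 : ℂ, conj A22 = 0 → conj A21 = -conj A11 * a₁ / b₁ →
      A11 * A12 ≠ 0 →
      (A11*A22 - A12*A21 ≠ 0 ∧ tb1 a₁ 0 b₁ 0 c₁ c₂ A11 A12 A21 A22 = 0 ∧
        tb2 a₁ 0 b₁ 0 c₁ c₂ A11 A12 A21 A22 = 0) := by
    intro A11 A12 A21 A22 h22 h21 hA
    have hA22 : A22 = 0 := by simpa using h22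
    have hA11 : A11 ≠ 0 := left_ne_zero_of_mul hA
    have hA12 : A12 ≠ 0 := right_ne_zero_of_mul hA
    have hA21 : A21 ≠ 0 := by
      rw [← map_ne_zero (starRingEnd ℂ), h21]
      exact div_ne_zero (mul_ne_zero (neg_ne_zero.mpr (by simpa using hA11)) ha) hb
    have hcancel : a₁ * conj A11 + b₁ * conj A21 = 0 := by
      rw [h21]
      field_simp
      ring
    refine ⟨by simp [hA22, hA12, hA21], ?_, ?_⟩
    · simp only [tb1, h22]
      linear_combination A11 * conj A12 * hcancel
    · simp only [tb2, h22]
      linear_combination A12 * conj A12 * hcancel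
  exact ⟨⟨1, 1, conj (-a₁ / b₁), 0, key _ _ _ _ (by simp) (by simp) (by simp)⟩, key⟩
end

section
/- Assume b₂ = 0, a₂b₁ ≠ 0, b₁c₂ ≠ 0 and a₁c₂ − a₂c₁ ≠ 0. Then there exist complex numbers A¹₁, A¹₂, A²₁, A²₂ with A¹₁A²₂ − A¹₂A²₁ ≠ 0 such that b′₂ = 0 and at least one of the following holds: b′₁ = 0, or a′₂ = 0, or c′₂ = 0. (Case Δ_ab·Δ_ac·Δ_bc ≠ 0 of the proof of Theorem A (ii), Section 8.5) -/
open ComplexConjugate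

/-- Section 8.5 (case `Δ_ab·Δ_ac·Δ_bc ≠ 0`): there is an invertible linear change of
coordinates with `b′₂ = 0` and at least one of `b′₁ = 0`, `a′₂ = 0`, `c′₂ = 0`. -/
theorem ebenfelt_section_8_5 (a₁ a₂ b₁ b₂ c₁ c₂ : ℂ)
    (hb2 : b₂ = 0) (hab : a₂*b₁ ≠ 0) (hbc : b₁*c₂ ≠ 0) (hac : a₁*c₂ - a₂*c₁ ≠ 0) :
    ∃ A11 A12 A21 A22 : ℂ, A11*A22 - A12*A21 ≠ 0 ∧
      tb2 a₁ a₂ b₁ b₂ c₁ c₂ A11 A12 A21 A22 = 0 ∧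
      (tb1 a₁ a₂ b₁ b₂ c₁ c₂ A11 A12 A21 A22 = 0 ∨ ta2 a₁ a₂ b₁ b₂ c₁ c₂ A11 A12 A21 A22 = 0 ∨ tc2 a₁ a₂ b₁ b₂ c₁ c₂ A11 A12 A21 A22 = 0) := by
  subst hb2
  have ha2 := left_ne_zero_of_mul hab
  obtain ⟨s, hs⟩ := IsAlgClosed.exists_pow_nat_eq
    ((a₂*c₁ - a₁*c₂)^2 + 4*(b₁*c₂)*(a₂*b₁)) two_pos
  have hk1 : 2*(b₁*c₂) ≠ 0 := mul_ne_zero two_ne_zero hbc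
  by_cases hs0 : s = 0
  · -- The two quadratic forms share the root `(k₁, k₂)`.
    subst hs0
    obtain ⟨k₁, hk₁⟩ : ∃ k, k = 2*(b₁*c₂) := ⟨_, rfl⟩
    obtain ⟨k₂, hk₂⟩ : ∃ k, k = a₂*c₁ - a₁*c₂ := ⟨_, rfl⟩
    obtain ⟨v₁, hv₁⟩ : ∃ v, v = a₂*k₁ := ⟨_, rfl⟩
    obtain ⟨v₂, hv₂⟩ : ∃ v, v = -(a₁*k₁ + b₁*k₂) := ⟨_, rfl⟩
    rw [← hk₁] at hk1
    have hv1 : v₁ ≠ 0 := hv₁ ▸ mul_ne_zero ha2 hk1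
    have e₁ : v₁*(a₁*k₁ + b₁*k₂) + v₂*(a₂*k₁) = 0 := by
      rw [hv₁, hv₂]; ring
    have e₂ : v₁*(b₁*k₁ + c₁*k₂) + v₂*(c₂*k₂) = 0 := by
      rw [hv₁, hv₂, hk₁, hk₂]
      linear_combination -(b₁ * c₂) * hs
    by_cases hd : conj k₁ * v₂ - v₁ * conj k₂ = 0
    · have hd' : k₁ * conj v₂ - conj v₁ * k₂ = 0 := by
        simpa using congrArg conj hd
      refine ⟨0, v₁, 1, v₂, by simpa using hv1, ?_, Or.inr (Or.inr ?_)⟩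
      · apply mul_left_cancel₀ hk1
        simp only [tb2, map_zero, map_one]
        linear_combination conj v₁ * e₂ + (v₁*c₁ + v₂*c₂) * hd'
      · apply mul_left_cancel₀ hk1
        simp only [tc2]
        linear_combination (conj v₁)^2 * e₁ + conj v₁ * conj v₂ * e₂
          + (v₁*b₁*conj v₁ + (v₁*c₁ + v₂*c₂)*conj v₂) * hd'
    · refine ⟨conj k₁, v₁, conj k₂, v₂, hd, ?_, Or.inr (Or.inl ?_)⟩
      · simp only [tb2, Complex.conj_conj]
        linear_combination conj v₁ * e₁ + conj v₂ * e₂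
      · simp only [ta2, Complex.conj_conj]
        linear_combination k₁ * e₁ + k₂ * e₂
  · refine ⟨conj (2*(b₁*c₂)), conj (2*(b₁*c₂)), conj (a₂*c₁ - a₁*c₂ + s),
      conj (a₂*c₁ - a₁*c₂ - s), ?_, ?_, Or.inl ?_⟩
    · rw [← map_mul, ← map_mul, ← map_sub, map_ne_zero]
      have h := mul_ne_zero (mul_ne_zero two_ne_zero hk1) hs0
      exact fun h0 => h (by linear_combination -h0)
    · simp only [tb2, Complex.conj_conj]
      linear_combination -(conj (2*(b₁*c₂)) * c₁ + conj (a₂*c₁ - a₁*c₂ - s) * c₂) * hs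
    · simp only [tb1, Complex.conj_conj]
      linear_combination -(conj (2*(b₁*c₂)) * c₁ + conj (a₂*c₁ - a₁*c₂ + s) * c₂) * hs
end

section
/- Assume b₂ = 0, c₁ = c₂ = 0 and a₂b₁ ≠ 0. If the matrix A is invertible (A¹₁A²₂ − A¹₂A²₁ ≠ 0), satisfies b′₂ = 0, and has A¹₂ ≠ 0, then c′₂ ≠ 0. (Impossibility of normalizing c′₂ with A¹₂ ≠ 0, Section 7.2) -/
open ComplexConjugate

/-- Section 7.2: with `b₂ = 0`, `c₁ = c₂ = 0` and `a₂b₁ ≠ 0`, an invertible change of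
coordinates with `b′₂ = 0` and `A¹₂ ≠ 0` cannot make `c′₂` vanish. -/
theorem ebenfelt_section_7_2_c2 (a₁ a₂ b₁ b₂ c₁ c₂ : ℂ)
    (hb2 : b₂ = 0) (hc1 : c₁ = 0) (hc2 : c₂ = 0) (hab : a₂*b₁ ≠ 0) :
    ∀ A11 A12 A21 A22 : ℂ, A11*A22 - A12*A21 ≠ 0 →
      tb2 a₁ a₂ b₁ b₂ c₁ c₂ A11 A12 A21 A22 = 0 → A12 ≠ 0 →
      tc2 a₁ a₂ b₁ b₂ c₁ c₂ A11 A12 A21 A22 ≠ 0 := by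
  intro p q r s hdet hb hq hc
  subst hb2 hc1 hc2
  have key : b₁ * q * conj q * conj (p * s - q * r) = 0 := by
    simp only [tb2] at hb
    simp only [tc2] at hc
    simp only [map_sub, map_mul]
    linear_combination conj p * hc - conj q * hb
  have hdet' : conj (p * s - q * r) ≠ 0 := (map_ne_zero _).mpr hdet
  have hq' : conj q ≠ 0 := (map_ne_zero _).mpr hq
  exact mul_ne_zero (mul_ne_zero (mul_ne_zero (right_ne_zero_of_mul hab) hq) hq') hdet' key
end

section
/- Assume a₁ = a₂ = b₂ = 0, b₁c₂ ≠ 0 and c₁ ≠ 0, and set λ = 2·conj(b₁)·c₂/|c₁|². Then there exist complex numbers A¹₁, A¹₂, A²₁, A²₂ with A¹₁A²₂ − A¹₂A²₁ ≠ 0 such that a′₁ = 0, a′₂ = 0, b′₂ = 0, b′₁ = −i, c′₁ = −2i and c′₂ = −2iλ. (Reduction to the form (A.ii.3), Section 7.3) -/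
open ComplexConjugate

theorem exists_pos_mul_pow_six_eq {b c : ℂ} (hb : b ≠ 0) (hc : c ≠ 0) :
    ∃ R : ℝ, 0 < R ∧ 4 * (R : ℂ) ^ 6 * (b * conj b) ^ 2 = c * conj c := by
  have hNb := Complex.normSq_pos.mpr hb
  have hNc := Complex.normSq_pos.mpr hc
  have hx : 0 < Complex.normSq c / (4 * Complex.normSq b ^ 2) := by positivity
  refine ⟨(Complex.normSq c / (4 * Complex.normSq b ^ 2)) ^ ((6 : ℕ) : ℝ)⁻¹,
    Real.rpow_pos_of_pos hx _, ?_⟩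
  rw [← Complex.ofReal_pow, Real.rpow_inv_natCast_pow hx.le (by norm_num),
    Complex.mul_conj, Complex.mul_conj]
  have hNb' : (Complex.normSq b : ℂ) ≠ 0 := Complex.ofReal_ne_zero.mpr hNb.ne'
  push_cast
  field_simp

/-- Section 7.3 (reduction to (A.ii.3)): if `a₁ = a₂ = b₂ = 0`, `b₁c₂ ≠ 0` and `c₁ ≠ 0`,
setting `λ = 2b̄₁c₂/|c₁|²`, there is an invertible linear change of coordinates with
`a′₁ = a′₂ = b′₂ = 0`, `b′₁ = −i`, `c′₁ = −2i` and `c′₂ = −2iλ`. -/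
theorem ebenfelt_section_7_3_Aii3 (a₁ a₂ b₁ b₂ c₁ c₂ lam : ℂ)
    (ha1 : a₁ = 0) (ha2 : a₂ = 0) (hb2 : b₂ = 0)
    (hbc : b₁*c₂ ≠ 0) (hc1 : c₁ ≠ 0)
    (hlam : lam = 2 * conj b₁ * c₂ / (Complex.normSq c₁ : ℂ)) :
    ∃ A11 A12 A21 A22 : ℂ, A11*A22 - A12*A21 ≠ 0 ∧
      ta1 a₁ a₂ b₁ b₂ c₁ c₂ A11 A12 A21 A22 = 0 ∧
      ta2 a₁ a₂ b₁ b₂ c₁ c₂ A11 A12 A21 A22 = 0 ∧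
      tb2 a₁ a₂ b₁ b₂ c₁ c₂ A11 A12 A21 A22 = 0 ∧
      tb1 a₁ a₂ b₁ b₂ c₁ c₂ A11 A12 A21 A22 = -Complex.I ∧
      tc1 a₁ a₂ b₁ b₂ c₁ c₂ A11 A12 A21 A22 = -2*Complex.I ∧
      tc2 a₁ a₂ b₁ b₂ c₁ c₂ A11 A12 A21 A22 = -2*Complex.I*lam := by
  subst ha1 ha2 hb2 hlam
  have hb : b₁ ≠ 0 := left_ne_zero_of_mul hbc
  obtain ⟨R, hR0, hR⟩ := exists_pos_mul_pow_six_eq hb hc1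
  have hR0' : (R : ℂ) ≠ 0 := Complex.ofReal_ne_zero.mpr hR0.ne'
  have hB : conj b₁ ≠ 0 := (map_ne_zero _).mpr hb
  have hC : conj c₁ ≠ 0 := (map_ne_zero _).mpr hc1
  refine ⟨2 * Complex.I * R ^ 4 * b₁ ^ 2 / c₁, 0, 0, Complex.I / (R ^ 2 * conj b₁),
    ?_, ?_, ?_, ?_, ?_, ?_, ?_⟩
  · simp [hb, hc1, hR0.ne']
  · simp [ta1]
  · simp [ta2]
  · simp [tb2]
  · simp only [tb1, map_div₀, map_mul, map_pow, map_ofNat, map_zero, Complex.conj_I,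
      Complex.conj_ofReal, Complex.conj_conj]
    field_simp
    ring_nf
    simp only [Complex.I_pow_three]
    linear_combination (-Complex.I * R ^ 2 * b₁) * hR
  · simp only [tc1, map_div₀, map_mul, map_pow, map_zero, Complex.conj_I,
      Complex.conj_ofReal, Complex.conj_conj]
    field_simp
    ring_nf
    simp only [Complex.I_pow_three]
    ring
  · simp only [tc2, map_div₀, map_mul, map_pow, map_zero, Complex.conj_I,
      Complex.conj_ofReal, Complex.conj_conj, ← Complex.mul_conj]
    field_simp
    ring_nf
    simp only [Complex.I_pow_three]
    linear_combination (Complex.I * c₂) * hR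
end

section
/- Assume b₁ = b₂ = 0 and a₁c₂ ≠ 0. Then there exist complex numbers A¹₁, A¹₂, A²₁, A²₂ with A¹₁A²₂ − A¹₂A²₁ ≠ 0 such that b′₁ = 0, b′₂ = 0, a′₁ = −2i and c′₂ = −2i. (Reduction to the form (A.ii.4), Section 7.4) -/
open ComplexConjugate

/-- The map `z ↦ z * conj z ^ 2` hits every nonzero complex number. -/
theorem exists_mul_conj_sq_eq {w : ℂ} (hw : w ≠ 0) : ∃ z : ℂ, z ≠ 0 ∧ z * conj z ^ 2 = w := by
  have hpos : 0 < (Complex.normSq w)⁻¹ := inv_pos.mpr (Complex.normSq_pos.mpr hw)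
  obtain ⟨r, hr⟩ : ∃ r : ℝ, r ^ 3 = (Complex.normSq w)⁻¹ :=
    ⟨(Complex.normSq w)⁻¹ ^ ((3 : ℕ) : ℝ)⁻¹, Real.rpow_inv_natCast_pow hpos.le three_ne_zero⟩
  have hprod : (r * conj w) * conj (r * conj w) ^ 2 = w := by
    have hr' : (r : ℂ) ^ 3 * (w * conj w) = 1 := by
      rw [Complex.mul_conj, ← Complex.ofReal_pow, ← Complex.ofReal_mul, hr,
        inv_mul_cancel₀ (Complex.normSq_pos.mpr hw).ne', Complex.ofReal_one]
    simp only [map_mul, Complex.conj_ofReal, Complex.conj_conj]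
    linear_combination w * hr'
  refine ⟨r * conj w, fun h => hw ?_, hprod⟩
  rw [← hprod, h, zero_mul]

/-- Section 7.4 (reduction to (A.ii.4)): if `b₁ = b₂ = 0` and `a₁c₂ ≠ 0`, there is an
invertible linear change of coordinates with `b′₁ = b′₂ = 0`, `a′₁ = −2i`, `c′₂ = −2i`. -/
theorem ebenfelt_section_7_4_Aii4 (a₁ a₂ b₁ b₂ c₁ c₂ : ℂ)
    (hb1 : b₁ = 0) (hb2 : b₂ = 0) (hac : a₁*c₂ ≠ 0) :
    ∃ A11 A12 A21 A22 : ℂ, A11*A22 - A12*A21 ≠ 0 ∧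
      tb1 a₁ a₂ b₁ b₂ c₁ c₂ A11 A12 A21 A22 = 0 ∧
      tb2 a₁ a₂ b₁ b₂ c₁ c₂ A11 A12 A21 A22 = 0 ∧
      ta1 a₁ a₂ b₁ b₂ c₁ c₂ A11 A12 A21 A22 = -2*Complex.I ∧
      tc2 a₁ a₂ b₁ b₂ c₁ c₂ A11 A12 A21 A22 = -2*Complex.I := by
  subst hb1 hb2
  obtain ⟨ha, hc⟩ := mul_ne_zero_iff.mp hac
  have hI : -2 * Complex.I ≠ 0 := mul_ne_zero (by norm_num) Complex.I_ne_zero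
  obtain ⟨z, hz, hza⟩ := exists_mul_conj_sq_eq (div_ne_zero hI ha)
  obtain ⟨u, hu, huc⟩ := exists_mul_conj_sq_eq (div_ne_zero hI hc)
  rw [eq_div_iff ha] at hza
  rw [eq_div_iff hc] at huc
  refine ⟨z, 0, 0, u, by simp [hz, hu], by simp [tb1], by simp [tb2], ?_, ?_⟩
  · simp only [ta1, map_zero]
    linear_combination hza
  · simp only [tc2, map_zero]
    linear_combination huc
end

section
/- With φ, φ̂, Q̄ and m as in the context, the function z ↦ Q̄(conj(z), z, 0) + 2i·φ(z, conj(z), 0)/(1 + i·φ̂(z, conj(z), 0)) is O(‖z‖^{2m+2}) as z → 0 in ℂ². (Proposition 5.7) -/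
open ComplexConjugate Filter Asymptotics Topology

/-- Schwarz lemma at the origin for a bounded holomorphic function vanishing there. -/
lemma norm_le_div_mul_norm_of_differentiableOn_ball {E : Type*} [NormedAddCommGroup E]
    [NormedSpace ℂ E] {f : E → ℂ} {M R : ℝ} (hd : DifferentiableOn ℂ f (Metric.ball 0 R))
    (hM : ∀ x ∈ Metric.ball (0 : E) R, ‖f x‖ ≤ M) (h0 : f 0 = 0) {z : E}
    (hz : z ∈ Metric.ball (0 : E) R) : ‖f z‖ ≤ M / R * ‖z‖ := by
  have h := Complex.dist_le_div_mul_dist_of_mapsTo_ball (R₂ := M) hd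
    (fun x hx => by simpa [h0] using hM x hx) hz
  simpa [h0] using h

lemma mem_ball_zero_prod_prod {E F G : Type*} [NormedAddCommGroup E] [NormedAddCommGroup F]
    [NormedAddCommGroup G] {R : ℝ} {x : E} {y : F} {u : G} :
    (x, y, u) ∈ Metric.ball (0 : E × F × G) R ↔
      x ∈ Metric.ball (0 : E) R ∧ y ∈ Metric.ball (0 : F) R ∧ u ∈ Metric.ball (0 : G) R := by
  simp [Prod.norm_def]

/-- An analytic function of three vector variables that vanishes as soon as one of the variables
does is bounded by a multiple of the product of their norms. -/
lemma AnalyticAt.isBigO_norm_mul_norm_mul_norm {E F G : Type*} [NormedAddCommGroup E]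
    [NormedSpace ℂ E] [NormedAddCommGroup F] [NormedSpace ℂ F] [NormedAddCommGroup G]
    [NormedSpace ℂ G] {f : E × F × G → ℂ} (hf : AnalyticAt ℂ f 0)
    (h : ∀ᶠ p : E × F × G in 𝓝 0,
      f (0, p.2.1, p.2.2) = 0 ∧ f (p.1, 0, p.2.2) = 0 ∧ f (p.1, p.2.1, 0) = 0) :
    f =O[𝓝 0] fun p => ‖p.1‖ * ‖p.2.1‖ * ‖p.2.2‖ := by
  obtain ⟨M, hM⟩ : ∃ M, ∀ᶠ p in 𝓝 (0 : E × F × G), ‖f p‖ ≤ M :=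
    ⟨‖f 0‖ + 1, (hf.continuousAt.norm.eventually_lt_const (lt_add_one _)).mono fun _ => le_of_lt⟩
  obtain ⟨R, hR, hball⟩ := Metric.eventually_nhds_iff_ball.mp
    (hf.eventually_analyticAt.and (h.and hM))
  have key : ∀ x ∈ Metric.ball (0 : E) R, ∀ y ∈ Metric.ball (0 : F) R,
      ∀ u ∈ Metric.ball (0 : G) R, ‖f (x, y, u)‖ ≤ M / R * ‖x‖ / R * ‖y‖ / R * ‖u‖ := by
    intro x hx y hy u hu
    have hd : ∀ x ∈ Metric.ball (0 : E) R, ∀ y ∈ Metric.ball (0 : F) R,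
        ∀ u ∈ Metric.ball (0 : G) R, DifferentiableAt ℂ f (x, y, u) := fun x hx y hy u hu =>
      (hball _ (mem_ball_zero_prod_prod.mpr ⟨hx, hy, hu⟩)).1.differentiableAt
    have h1 : ∀ y ∈ Metric.ball (0 : F) R, ∀ u ∈ Metric.ball (0 : G) R,
        ‖f (x, y, u)‖ ≤ M / R * ‖x‖ := fun y hy u hu =>
      norm_le_div_mul_norm_of_differentiableOn_ball (f := fun x => f (x, y, u))
        (fun x hx => ((hd x hx y hy u hu).comp x (f := fun x => (x, y, u))
          (by fun_prop)).differentiableWithinAt)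
        (fun x hx => (hball _ (mem_ball_zero_prod_prod.mpr ⟨hx, hy, hu⟩)).2.2)
        (hball _ (mem_ball_zero_prod_prod.mpr ⟨hx, hy, hu⟩)).2.1.1 hx
    have h2 : ∀ u ∈ Metric.ball (0 : G) R,
        ‖f (x, y, u)‖ ≤ M / R * ‖x‖ / R * ‖y‖ := fun u hu =>
      norm_le_div_mul_norm_of_differentiableOn_ball (f := fun y => f (x, y, u))
        (fun y hy => ((hd x hx y hy u hu).comp y (f := fun y => (x, y, u))
          (by fun_prop)).differentiableWithinAt)
        (fun y hy => h1 y hy u hu)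
        (hball _ (mem_ball_zero_prod_prod.mpr ⟨hx, hy, hu⟩)).2.1.2.1 hy
    exact norm_le_div_mul_norm_of_differentiableOn_ball (f := fun u => f (x, y, u))
      (fun u hu => ((hd x hx y hy u hu).comp u (f := fun u => (x, y, u))
        (by fun_prop)).differentiableWithinAt)
      h2 (hball _ (mem_ball_zero_prod_prod.mpr ⟨hx, hy, hu⟩)).2.1.2.2 hu
  refine IsBigO.of_bound (M / R / R / R) ?_
  filter_upwards [Metric.ball_mem_nhds _ hR] with p hp
  obtain ⟨hx, hy, hu⟩ := mem_ball_zero_prod_prod.mp (show (p.1, p.2.1, p.2.2) ∈ _ from hp)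
  refine (key _ hx _ hy _ hu).trans_eq ?_
  rw [Real.norm_of_nonneg (by positivity)]
  ring

/-- If `u * f (x, u) = 0` near the origin and `f` is continuous near the origin, then `f` vanishes
near the origin. -/
lemma eventually_eq_zero_of_snd_mul_eq_zero {E : Type*} [NormedAddCommGroup E] {f : E × ℂ → ℂ}
    (hf : ∀ᶠ p in 𝓝 (0 : E × ℂ), ContinuousAt f p)
    (h : ∀ᶠ p in 𝓝 (0 : E × ℂ), p.2 * f p = 0) : ∀ᶠ p in 𝓝 (0 : E × ℂ), f p = 0 := by
  filter_upwards [hf, h.eventually_nhds] with ⟨x, u⟩ hc hp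
  have hcu : ContinuousAt (fun v => f (x, v)) u :=
    ContinuousAt.comp (f := fun v => (x, v)) hc (by fun_prop)
  have hlim : Tendsto (fun v => f (x, v)) (𝓝[≠] u) (𝓝 (f (x, u))) :=
    hcu.tendsto.mono_left nhdsWithin_le_nhds
  have hpu : ∀ᶠ v in 𝓝 u, v * f (x, v) = 0 :=
    (show ContinuousAt (fun v : ℂ => (x, v)) u by fun_prop).eventually hp
  have hne : ∀ᶠ v in 𝓝[≠] u, v ≠ 0 := by
    rcases eq_or_ne u 0 with rfl | hu
    · exact self_mem_nhdsWithin
    · exact nhdsWithin_le_nhds (isOpen_ne.mem_nhds hu)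
  refine tendsto_nhds_unique (hlim.congr' ?_) tendsto_const_nhds
  filter_upwards [hne, nhdsWithin_le_nhds hpu] with v hv hv'
  exact (mul_eq_zero.mp hv').resolve_left hv

/-- Proposition 5.7: with `M` given in regular form `Im w = φ(z, z̄, Re w)`, complex defining
equation `w̄ = Q̄(z̄, z, w)` in complex regular form, `φ(z, χ, u) = φ(z, χ, 0) + u·φ̂(z, χ, u)`,
and `φ(z, z̄, 0) = O(‖z‖^m)`, one has
`Q̄(z̄, z, 0) = −2i·φ(z, z̄, 0)/(1 + i·φ̂(z, z̄, 0)) + O(‖z‖^{2m+2})`. -/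
theorem ebenfelt_prop_5_7
    (φ Q φh : (ℂ × ℂ) × (ℂ × ℂ) × ℂ → ℂ)
    (hφ : AnalyticAt ℂ φ 0) (hQ : AnalyticAt ℂ Q 0) (hφh : AnalyticAt ℂ φh 0)
    (hQ0 : Q 0 = 0)
    (hreg : ∀ᶠ p : (ℂ × ℂ) × (ℂ × ℂ) × ℂ in 𝓝 0,
      φ (p.1, 0, p.2.2) = 0 ∧ φ (0, p.2.1, p.2.2) = 0)
    (himp : ∀ᶠ p : (ℂ × ℂ) × (ℂ × ℂ) × ℂ in 𝓝 0,
      p.2.2 - Q (p.2.1, p.1, p.2.2)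
        = 2 * Complex.I * φ (p.1, p.2.1, (p.2.2 + Q (p.2.1, p.1, p.2.2)) / 2))
    (hsplit : ∀ᶠ p : (ℂ × ℂ) × (ℂ × ℂ) × ℂ in 𝓝 0,
      φ p = φ (p.1, p.2.1, 0) + p.2.2 * φh p)
    (m : ℕ) (hm : 2 ≤ m)
    (hO : (fun z : ℂ × ℂ => φ (z, (conj z.1, conj z.2), 0)) =O[𝓝 0] fun z => ‖z‖ ^ m) :
    (fun z : ℂ × ℂ =>
        Q ((conj z.1, conj z.2), z, 0)
          + 2 * Complex.I * φ (z, (conj z.1, conj z.2), 0)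
              / (1 + Complex.I * φh (z, (conj z.1, conj z.2), 0)))
      =O[𝓝 0] fun z => ‖z‖ ^ (2 * m + 2) := by
  have hφh0 : ∀ᶠ p : (ℂ × ℂ) × (ℂ × ℂ) × ℂ in 𝓝 0,
      φh (p.1, 0, p.2.2) = 0 ∧ φh (0, p.2.1, p.2.2) = 0 := by
    have hc := hφh.eventually_analyticAt.mono fun _ h => h.continuousAt
    have h1 : ∀ᶠ p : (ℂ × ℂ) × ℂ in 𝓝 0, φh (p.1, 0, p.2) = 0 := by
      have t : Tendsto (fun p : (ℂ × ℂ) × ℂ => (p.1, (0 : ℂ × ℂ), p.2)) (𝓝 0) (𝓝 0) :=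
        Continuous.tendsto' (by fun_prop) _ _ rfl
      have t0 : Tendsto (fun p : (ℂ × ℂ) × ℂ => (p.1, (0 : ℂ × ℂ), (0 : ℂ))) (𝓝 0) (𝓝 0) :=
        Continuous.tendsto' (by fun_prop) _ _ rfl
      refine eventually_eq_zero_of_snd_mul_eq_zero (f := fun p : (ℂ × ℂ) × ℂ => φh (p.1, 0, p.2))
        ((t.eventually hc).mono fun p hp =>
          ContinuousAt.comp (f := fun p : (ℂ × ℂ) × ℂ => (p.1, (0 : ℂ × ℂ), p.2)) hp
            (by fun_prop)) ?_
      filter_upwards [t.eventually hsplit, t.eventually hreg, t0.eventually hreg] with p hs hr hr0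
      simpa [hr.1, hr0.1] using hs
    have h2 : ∀ᶠ p : (ℂ × ℂ) × ℂ in 𝓝 0, φh (0, p.1, p.2) = 0 := by
      have t : Tendsto (fun p : (ℂ × ℂ) × ℂ => ((0 : ℂ × ℂ), p.1, p.2)) (𝓝 0) (𝓝 0) :=
        Continuous.tendsto' (by fun_prop) _ _ rfl
      have t0 : Tendsto (fun p : (ℂ × ℂ) × ℂ => ((0 : ℂ × ℂ), p.1, (0 : ℂ))) (𝓝 0) (𝓝 0) :=
        Continuous.tendsto' (by fun_prop) _ _ rfl
      refine eventually_eq_zero_of_snd_mul_eq_zero (f := fun p : (ℂ × ℂ) × ℂ => φh (0, p.1, p.2))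
        ((t.eventually hc).mono fun p hp =>
          ContinuousAt.comp (f := fun p : (ℂ × ℂ) × ℂ => ((0 : ℂ × ℂ), p.1, p.2)) hp
            (by fun_prop)) ?_
      filter_upwards [t.eventually hsplit, t.eventually hreg, t0.eventually hreg] with p hs hr hr0
      simpa [hr.2, hr0.2] using hs
    have t1 : Tendsto (fun p : (ℂ × ℂ) × (ℂ × ℂ) × ℂ => (p.1, p.2.2)) (𝓝 0) (𝓝 0) :=
      Continuous.tendsto' (by fun_prop) _ _ rfl
    have t2 : Tendsto (fun p : (ℂ × ℂ) × (ℂ × ℂ) × ℂ => (p.2.1, p.2.2)) (𝓝 0) (𝓝 0) :=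
      Continuous.tendsto' (by fun_prop) _ _ rfl
    exact (t1.eventually h1).and (t2.eventually h2)
  have hdiff : (fun p : (ℂ × ℂ) × (ℂ × ℂ) × ℂ => φh p - φh (p.1, p.2.1, 0))
      =O[𝓝 0] fun p => ‖p.1‖ * ‖p.2.1‖ * ‖p.2.2‖ := by
    have ht : Tendsto (fun p : (ℂ × ℂ) × (ℂ × ℂ) × ℂ => (p.1, p.2.1, (0 : ℂ))) (𝓝 0) (𝓝 0) :=
      Continuous.tendsto' (by fun_prop) _ _ rfl
    refine AnalyticAt.isBigO_norm_mul_norm_mul_norm (hφh.sub ?_) ?_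
    · exact AnalyticAt.comp (g := φh)
        (f := fun p : (ℂ × ℂ) × (ℂ × ℂ) × ℂ => (p.1, p.2.1, (0 : ℂ))) hφh
        (analyticAt_fst.prod ((analyticAt_fst.comp analyticAt_snd).prod analyticAt_const))
    · filter_upwards [hφh0, ht.eventually hφh0] with p hp hp0
      simp_all
  have hconj : Continuous fun z : ℂ × ℂ => (conj z.1, conj z.2) := by fun_prop
  set q : ℂ × ℂ → ℂ := fun z => Q ((conj z.1, conj z.2), z, 0)
  have hqt : Tendsto q (𝓝 0) (𝓝 0) := by
    have hc : Tendsto Q (𝓝 0) (𝓝 0) := by simpa [ContinuousAt, hQ0] using hQ.continuousAt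
    exact hc.comp (Continuous.tendsto' (by fun_prop) _ _ (by simp))
  have tz0 : Tendsto (fun z : ℂ × ℂ => (z, (conj z.1, conj z.2), (0 : ℂ))) (𝓝 0) (𝓝 0) :=
    Continuous.tendsto' (by fun_prop) _ _ (by simp)
  have tzq : Tendsto (fun z : ℂ × ℂ => (z, (conj z.1, conj z.2), q z / 2)) (𝓝 0) (𝓝 0) := by
    have h1 : Tendsto (fun z : ℂ × ℂ => (conj z.1, conj z.2)) (𝓝 0) (𝓝 0) :=
      hconj.tendsto' _ _ (by simp)
    have h2 : Tendsto (fun z => q z / 2) (𝓝 0) (𝓝 0) := by simpa using hqt.div_const 2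
    exact tendsto_id.prodMk_nhds (h1.prodMk_nhds h2)
  have hcφh : Tendsto φh (𝓝 0) (𝓝 0) := by
    have h00 : φh 0 = 0 := hφh0.self_of_nhds.1
    simpa [ContinuousAt, h00] using hφh.continuousAt
  -- Units `1 + i φ̂` have locally bounded inverses.
  have hunit : Tendsto (fun p => 1 + Complex.I * φh p) (𝓝 0) (𝓝 1) := by
    simpa using (hcφh.const_mul Complex.I).const_add 1
  have hinv : (fun p => (1 + Complex.I * φh p)⁻¹) =O[𝓝 0] fun _ => (1 : ℝ) :=
    (hunit.inv₀ one_ne_zero).isBigO_one ℝ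
  have hne := hunit.eventually_ne one_ne_zero
  have hfix : ∀ᶠ z in 𝓝 (0 : ℂ × ℂ),
      q z * (1 + Complex.I * φh (z, (conj z.1, conj z.2), q z / 2))
        = -(2 * Complex.I * φ (z, (conj z.1, conj z.2), 0)) := by
    filter_upwards [tz0.eventually himp, tzq.eventually hsplit] with z h1 h2
    simp only [zero_sub, zero_add] at h1
    change -q z = 2 * Complex.I * φ (z, (conj z.1, conj z.2), q z / 2) at h1
    rw [h2] at h1
    linear_combination -h1
  have hqO : q =O[𝓝 0] fun z => ‖z‖ ^ m := by
    have h := (hO.const_mul_left (-(2 * Complex.I))).mul (hinv.comp_tendsto tzq)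
    refine h.congr' ?_ (by simp)
    filter_upwards [hfix, tzq.eventually hne] with z hz hz'
    simp only [Function.comp]
    rw [neg_mul, ← hz, mul_inv_cancel_right₀ hz']
  have hΔ : (fun z : ℂ × ℂ => φh (z, (conj z.1, conj z.2), q z / 2)
      - φh (z, (conj z.1, conj z.2), 0)) =O[𝓝 0] fun z => ‖z‖ ^ (m + 2) := by
    refine (hdiff.comp_tendsto tzq).trans ?_
    have h3 : (fun z : ℂ × ℂ => ‖q z / 2‖) =O[𝓝 0] fun z => ‖z‖ ^ m := by
      simpa [div_eq_inv_mul] using (hqO.const_mul_left 2⁻¹).norm_left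
    have h := (isBigO_refl (fun z : ℂ × ℂ => ‖z‖ * ‖z‖) (𝓝 0)).mul h3
    refine h.congr (fun z => ?_) fun z => by ring
    simp [Prod.norm_def]
  have h := ((hqO.mul hΔ).const_mul_left (-Complex.I)).mul (hinv.comp_tendsto tz0)
  refine h.congr' ?_ (.of_forall fun z => by simp only [Function.comp]; ring)
  filter_upwards [hfix, tz0.eventually hne] with z hz hz'
  simp only [Function.comp]
  change _ = q z + _
  field_simp
  linear_combination -hz
end

section
/- With φ, Q̄ and m as in the context, the function z ↦ Q̄(conj(z), z, 0) + 2i·φ(z, conj(z), 0) is O(‖z‖^{m+2}) as z → 0 in ℂ². (Corollary 5.11) -/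
open ComplexConjugate Filter Asymptotics Topology

open Metric in
/-- The **Schwarz lemma** for a map vanishing at the origin. -/
theorem norm_le_div_mul_norm_of_vanishing {E F : Type*}
    [NormedAddCommGroup E] [NormedSpace ℂ E] [NormedAddCommGroup F] [NormedSpace ℂ F]
    {f : E → F} {R M : ℝ} (hd : DifferentiableOn ℂ f (ball 0 R))
    (hM : ∀ z ∈ ball (0 : E) R, ‖f z‖ ≤ M) (h0 : f 0 = 0) {z : E} (hz : z ∈ ball 0 R) :
    ‖f z‖ ≤ M / R * ‖z‖ := by
  simpa [h0] using Complex.dist_le_div_mul_dist_of_mapsTo_ball hd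
    (fun w hw => by simpa [h0] using hM w hw) hz

open Metric in
/-- An analytic function `φ (z, χ, u)` vanishing for `z = 0` and for `χ = 0` varies by at most
a multiple of `‖z‖ * ‖χ‖ * ‖u‖` between `(z, χ, 0)` and `(z, χ, u)`. -/
theorem AnalyticAt.exists_eventually_norm_sub_le_of_vanishing {E F G H : Type*}
    [NormedAddCommGroup E] [NormedSpace ℂ E] [NormedAddCommGroup F] [NormedSpace ℂ F]
    [NormedAddCommGroup G] [NormedSpace ℂ G] [NormedAddCommGroup H] [NormedSpace ℂ H]
    [CompleteSpace H] {φ : E × F × G → H} (hφ : AnalyticAt ℂ φ 0)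
    (hreg : ∀ᶠ p : E × F × G in 𝓝 0, φ (p.1, 0, p.2.2) = 0 ∧ φ (0, p.2.1, p.2.2) = 0) :
    ∃ C : ℝ, 0 ≤ C ∧ ∀ᶠ p : E × F × G in 𝓝 0,
      ‖φ p - φ (p.1, p.2.1, 0)‖ ≤ C * ‖p.1‖ * ‖p.2.1‖ * ‖p.2.2‖ := by
  have hbdd : ∀ᶠ p in 𝓝 0, ‖φ p‖ < ‖φ 0‖ + 1 :=
    hφ.continuousAt.norm.eventually_lt continuousAt_const (by simp)
  obtain ⟨R, hR, hball⟩ := Metric.eventually_nhds_iff_ball.1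
    (hφ.eventually_analyticAt.and (hbdd.and hreg))
  have hmem {z : E} {χ : F} {u : G} (hz : z ∈ ball 0 R) (hχ : χ ∈ ball 0 R)
      (hu : u ∈ ball 0 R) : (z, χ, u) ∈ ball (0 : E × F × G) R := by
    simp_all [Prod.norm_def]
  set M := ‖φ 0‖ + 1
  have hdiff : ∀ p ∈ ball (0 : E × F × G) R, DifferentiableAt ℂ φ p :=
    fun p hp => (hball p hp).1.differentiableAt
  have hz_bound {z : E} {χ : F} {u : G} (hz : z ∈ ball 0 R) (hχ : χ ∈ ball 0 R)
      (hu : u ∈ ball 0 R) : ‖φ (z, χ, u)‖ ≤ M / R * ‖z‖ :=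
    norm_le_div_mul_norm_of_vanishing (f := fun z => φ (z, χ, u))
      (fun w hw => ((hdiff _ (hmem hw hχ hu)).comp w
        (f := fun z : E => (z, χ, u)) (by fun_prop)).differentiableWithinAt)
      (fun w hw => (hball _ (hmem hw hχ hu)).2.1.le)
      (hball _ (hmem hz hχ hu)).2.2.2 hz
  have hχ_bound {z : E} {χ : F} {u : G} (hz : z ∈ ball 0 R) (hχ : χ ∈ ball 0 R)
      (hu : u ∈ ball 0 R) : ‖φ (z, χ, u)‖ ≤ M / R * ‖z‖ / R * ‖χ‖ :=
    norm_le_div_mul_norm_of_vanishing (f := fun χ => φ (z, χ, u))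
      (fun w hw => ((hdiff _ (hmem hz hw hu)).comp w
        (f := fun χ : F => (z, χ, u)) (by fun_prop)).differentiableWithinAt)
      (fun w hw => hz_bound hz hw hu)
      (hball _ (hmem hz hχ hu)).2.2.1 hχ
  refine ⟨2 * M / R ^ 3, by positivity, ?_⟩
  filter_upwards [ball_mem_nhds 0 hR] with ⟨z, χ, u⟩ hp
  obtain ⟨hz, hχ, hu⟩ : z ∈ ball 0 R ∧ χ ∈ ball 0 R ∧ u ∈ ball 0 R := by
    simpa [Prod.norm_def] using hp
  have hu0 : (0 : G) ∈ ball 0 R := by simp [hR]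
  calc ‖φ (z, χ, u) - φ (z, χ, 0)‖
      ≤ (M / R * ‖z‖ / R * ‖χ‖ + M / R * ‖z‖ / R * ‖χ‖) / R * ‖u‖ :=
        norm_le_div_mul_norm_of_vanishing (f := fun u => φ (z, χ, u) - φ (z, χ, 0))
          (fun w hw => (((hdiff _ (hmem hz hχ hw)).comp w
            (f := fun u : G => (z, χ, u)) (by fun_prop)).sub_const _).differentiableWithinAt)
          (fun w hw => (norm_sub_le _ _).trans
            (add_le_add (hχ_bound hz hχ hw) (hχ_bound hz hχ hu0)))
          (sub_self _) hu
    _ = 2 * M / R ^ 3 * ‖z‖ * ‖χ‖ * ‖u‖ := by field_simp; ring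

/-- Corollary 5.11: with `M` given in regular form `Im w = φ(z, z̄, Re w)`, complex defining
equation `w̄ = Q̄(z̄, z, w)` in complex regular form, and `φ(z, z̄, 0) = O(‖z‖^m)`, one has
`Q̄(z̄, z, 0) = −2i·φ(z, z̄, 0) + O(‖z‖^{m+2})`. -/
theorem ebenfelt_cor_5_11
    (φ Q : (ℂ × ℂ) × (ℂ × ℂ) × ℂ → ℂ)
    (hφ : AnalyticAt ℂ φ 0) (hQ : AnalyticAt ℂ Q 0)
    (hQ0 : Q 0 = 0)
    (hreg : ∀ᶠ p : (ℂ × ℂ) × (ℂ × ℂ) × ℂ in 𝓝 0,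
      φ (p.1, 0, p.2.2) = 0 ∧ φ (0, p.2.1, p.2.2) = 0)
    (himp : ∀ᶠ p : (ℂ × ℂ) × (ℂ × ℂ) × ℂ in 𝓝 0,
      p.2.2 - Q (p.2.1, p.1, p.2.2)
        = 2 * Complex.I * φ (p.1, p.2.1, (p.2.2 + Q (p.2.1, p.1, p.2.2)) / 2))
    (m : ℕ) (hm : 2 ≤ m)
    (hO : (fun z : ℂ × ℂ => φ (z, (conj z.1, conj z.2), 0)) =O[𝓝 0] fun z => ‖z‖ ^ m) :
    (fun z : ℂ × ℂ =>
        Q ((conj z.1, conj z.2), z, 0) + 2 * Complex.I * φ (z, (conj z.1, conj z.2), 0))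
      =O[𝓝 0] fun z => ‖z‖ ^ (m + 2) := by
  obtain ⟨C, hC, hlip⟩ := hφ.exists_eventually_norm_sub_le_of_vanishing hreg
  set c : ℂ × ℂ → ℂ × ℂ := fun z => (conj z.1, conj z.2)
  have hc : Continuous c := by fun_prop
  have hc0 : c 0 = 0 := by simp [c]
  have hcnorm (z) : ‖c z‖ = ‖z‖ := by simp [c, Prod.norm_def]
  have hq : Tendsto (fun z => Q (c z, z, 0)) (𝓝 0) (𝓝 0) := by
    have hin : Tendsto (fun z : ℂ × ℂ => (c z, z, (0 : ℂ))) (𝓝 0) (𝓝 0) :=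
      (by fun_prop : Continuous fun z : ℂ × ℂ => (c z, z, (0 : ℂ))).tendsto' _ _ (by simp [hc0])
    have := hQ.continuousAt.tendsto.comp hin
    rwa [hQ0] at this
  have hp0 : Tendsto (fun z : ℂ × ℂ => (z, c z, (0 : ℂ))) (𝓝 0) (𝓝 0) :=
    (by fun_prop : Continuous fun z : ℂ × ℂ => (z, c z, (0 : ℂ))).tendsto' _ _ (by simp [hc0])
  have hpq : Tendsto (fun z : ℂ × ℂ => (z, c z, Q (c z, z, 0) / 2)) (𝓝 0) (𝓝 0) := by
    have := tendsto_id.prodMk_nhds ((hc.tendsto' _ _ hc0).prodMk_nhds (hq.div_const 2))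
    rwa [zero_div] at this
  have hsmall : ∀ᶠ z : ℂ × ℂ in 𝓝 0, C * ‖z‖ ^ 2 < 1 / 2 := by
    have : Continuous fun z : ℂ × ℂ => C * ‖z‖ ^ 2 := by fun_prop
    exact (this.tendsto' 0 0 (by simp)).eventually_lt_const (by norm_num)
  have key : (fun z : ℂ × ℂ => Q (c z, z, 0) + 2 * Complex.I * φ (z, c z, 0))
      =O[𝓝 0] fun z => ‖z‖ ^ 2 * ‖φ (z, c z, 0)‖ := by
    refine IsBigO.of_bound (4 * C) ?_
    filter_upwards [hp0.eventually himp, hpq.eventually hlip, hsmall] with z himp hlip hsmall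
    simp only [zero_sub, zero_add, hcnorm] at himp hlip
    set q := Q (c z, z, 0)
    set a := φ (z, c z, 0)
    set b := φ (z, c z, q / 2)
    have hr : ‖q + 2 * Complex.I * a‖ = 2 * ‖b - a‖ := by
      rw [show q + 2 * Complex.I * a = -(2 * Complex.I * (b - a)) by linear_combination -himp]
      simp
    have hqle : ‖q‖ ≤ ‖q + 2 * Complex.I * a‖ + 2 * ‖a‖ := by
      simpa using norm_sub_le (q + 2 * Complex.I * a) (2 * Complex.I * a)
    rw [norm_div, Complex.norm_ofNat] at hlip
    rw [norm_mul, norm_pow, norm_norm, norm_norm]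
    have hmul := mul_le_mul_of_nonneg_left hqle (by positivity : 0 ≤ C * ‖z‖ ^ 2)
    have hhalf := mul_le_mul_of_nonneg_right hsmall.le (norm_nonneg (q + 2 * Complex.I * a))
    linarith
  refine key.trans ?_
  simpa only [pow_add, mul_comm] using (isBigO_refl (fun z : ℂ × ℂ => ‖z‖ ^ 2) _).mul hO.norm_left
end

section
/- For a polynomial q in the polynomial ring ℂ[z₁, z₂, ζ₁, ζ₂], let D(q) = (∂_{z₁}∂_{ζ₁}q)·(∂_{z₂}∂_{ζ₂}q) − (∂_{z₁}∂_{ζ₂}q)·(∂_{z₂}∂_{ζ₁}q). Then D(q) ≠ 0 (i.e. D(q) is not the zero polynomial) for each of the following five polynomials, which are the complexified cubic parts of the model forms (A.ii.1)–(A.ii.5): (1) q = z₁ζ₁(z₂ + ζ₂) + r·(z₁²ζ₂ + ζ₁²z₂) for every real r > 0; (2) q = z₁ζ₁(z₂ + ζ₂) + (z₁²ζ₂ + ζ₁²z₂) + i·z₁ζ₁(z₁ − ζ₁); (3) q = z₁ζ₁(z₂ + ζ₂) + (z₁ζ₂² + ζ₁z₂²) + z₂ζ₂(λz₂ + conj(λ)ζ₂)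 for every λ ∈ ℂ with λ ≠ 0; (4) q = z₁ζ₁(z₁ + ζ₁) + z₂ζ₂(z₂ + ζ₂) + μz₁²ζ₂ + conj(μ)ζ₁²z₂ + νz₁ζ₂² + conj(ν)ζ₁z₂² for all μ, ν ∈ ℂ with μν ≠ 1; (5) q = z₁ζ₁(ηz₁ + conj(η)ζ₁) + (z₁²ζ₂ + ζ₁²z₂) + (z₁ζ₂² + ζ₁z₂²) for every η ∈ ℂ. (Claim (4.2.16) in the proof of Theorem 4.2.8: none of the cubics in (A.ii.1)–(A.ii.5) has identically degenerate complexified Levi form.) -/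
open MvPolynomial ComplexConjugate

/-- The complexified Levi determinant of a polynomial `q(z₁, z₂, ζ₁, ζ₂)` (variables indexed
`0 ↦ z₁`, `1 ↦ z₂`, `2 ↦ ζ₁`, `3 ↦ ζ₂`):
`D(q) = q_{z₁ζ₁}·q_{z₂ζ₂} − q_{z₁ζ₂}·q_{z₂ζ₁}`. -/
noncomputable def leviDet (q : MvPolynomial (Fin 4) ℂ) : MvPolynomial (Fin 4) ℂ :=
  (pderiv 0 (pderiv 2 q)) * (pderiv 1 (pderiv 3 q))
    - (pderiv 0 (pderiv 3 q)) * (pderiv 1 (pderiv 2 q))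

/-- A polynomial that does not vanish at some point is nonzero. -/
theorem MvPolynomial.ne_zero_of_eval_ne_zero {σ R : Type*} [CommSemiring R]
    {p : MvPolynomial σ R} (x : σ → R) (h : eval x p ≠ 0) : p ≠ 0 :=
  fun hp => h (by rw [hp, map_zero])

/-- Claim (4.2.16) in the proof of Theorem 4.2.8: none of the complexified cubics in the
model forms (A.ii.1)–(A.ii.5) has identically vanishing complexified Levi determinant. -/
theorem ebenfelt_claim_4_2_16 :
    (∀ r : ℝ, 0 < r →
      leviDet (X 0 * X 2 * (X 1 + X 3) + C (r : ℂ) * ((X 0)^2 * X 3 + (X 2)^2 * X 1)) ≠ 0) ∧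
    (leviDet (X 0 * X 2 * (X 1 + X 3) + ((X 0)^2 * X 3 + (X 2)^2 * X 1)
        + C Complex.I * (X 0 * X 2 * (X 0 - X 2))) ≠ 0) ∧
    (∀ lam : ℂ, lam ≠ 0 →
      leviDet (X 0 * X 2 * (X 1 + X 3) + (X 0 * (X 3)^2 + X 2 * (X 1)^2)
        + X 1 * X 3 * (C lam * X 1 + C (conj lam) * X 3)) ≠ 0) ∧
    (∀ μ ν : ℂ, μ * ν ≠ 1 →
      leviDet (X 0 * X 2 * (X 0 + X 2) + X 1 * X 3 * (X 1 + X 3)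
        + C μ * (X 0)^2 * X 3 + C (conj μ) * (X 2)^2 * X 1
        + C ν * X 0 * (X 3)^2 + C (conj ν) * X 2 * (X 1)^2) ≠ 0) ∧
    (∀ η : ℂ,
      leviDet (X 0 * X 2 * (C η * X 0 + C (conj η) * X 2)
        + ((X 0)^2 * X 3 + (X 2)^2 * X 1) + (X 0 * (X 3)^2 + X 2 * (X 1)^2)) ≠ 0) := by
  refine ⟨fun r hr => ?_, ?_, fun lam _ => ?_, fun μ ν _ => ?_, fun η => ?_⟩
  · refine ne_zero_of_eval_ne_zero ![1, 0, 0, 0] ?_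
    simp [leviDet, pderiv_X, hr.ne']
  · refine ne_zero_of_eval_ne_zero ![1, 0, 0, 0] ?_
    simp [leviDet, pderiv_X]
  · refine ne_zero_of_eval_ne_zero ![1, 0, 1, 0] ?_
    simp [leviDet, pderiv_X]
  · refine ne_zero_of_eval_ne_zero ![1, 0, 0, 1] ?_
    have h : pderiv 1 (2 : MvPolynomial (Fin 4) ℂ) = 0 := (pderiv 1).map_natCast 2
    simp [leviDet, pderiv_X, h]
  · refine ne_zero_of_eval_ne_zero ![1, 1, 0, 0] ?_
    simp [leviDet, pderiv_X]
end
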